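/- The Move-Half algorithm is dynamically optimal: for every request sequence σ, the total cost (access plus adjustment) of Move-Half on σ is at most 64 times the total cost of an optimal offline algorithm OPT serving σ from the same initial configuration; in particular Move-Half is a constant-competitive deterministic online algorithm for self-adjusting complete binary trees. -/

import Mathlib

/-!
Model: `n` items (elements of `Fin n`) are stored, one per server, on the `n`
servers of a fixed complete binary tree.  Servers are indexed in heap order by
`Fin n` (server `s` has heap index `s + 1`); the root (index `0`) has depth `0`.
A configuration is a bijection `Fin n ≃ Fin n` from items to servers; the depth
of an item is the depth of its hosting server.
-/

/-- Depth of the server with 0-based heap index `s` in the complete binary tree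
(the root, index `0`, has depth `0`). -/
def sDepth {n : ℕ} (s : Fin n) : ℕ := Nat.log 2 (s.val + 1)

/-- The parent server of `s` in the complete binary tree (the root is its own parent). -/
def sParent {n : ℕ} (s : Fin n) : Fin n :=
  ⟨(s.val + 1) / 2 - 1, by
    have h := Nat.div_le_self (s.val + 1) 2
    have h2 := s.isLt
    omega⟩

/-- Apply a list of swaps to a configuration (a bijection from items to servers):
each swap exchanges the item at the given server with the item at its parent server,
at unit cost per swap. -/
def applySwaps {n : ℕ} (l : List (Fin n)) (c : Fin n ≃ Fin n) : Fin n ≃ Fin n :=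
  l.foldl (fun c s => c.trans (Equiv.swap s (sParent s))) c

/-- The rank of item `v` at time `t` (the number of distinct items requested since the
last request to `v` prior to `t`, including `v`): upon a request to an item its rank
becomes `1`, the ranks of items with smaller rank increase by one, and all other ranks
are unchanged.  Initially the ranks are induced by the bijection `r0`
(`itemRank r0 σ 0 v = r0 v + 1`, a permutation of `1, …, n`). -/
def itemRank {n : ℕ} (r0 : Fin n ≃ Fin n) (σ : ℕ → Fin n) : ℕ → Fin n → ℕ
  | 0 => fun v => (r0 v).val + 1
  | t + 1 => fun v =>
      if v = σ t then 1
      else if itemRank r0 σ t v < itemRank r0 σ t (σ t) then itemRank r0 σ t v + 1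
      else itemRank r0 σ t v

section Levels

variable {n : ℕ}

lemma sDepth_eq_iff (s : Fin n) (j : ℕ) :
    sDepth s = j ↔ 2 ^ j ≤ s.val + 1 ∧ s.val + 1 < 2 ^ (j + 1) :=
  Nat.log_eq_iff (Or.inr ⟨by norm_num, by omega⟩)

lemma card_level_le (j : ℕ) :
    (Finset.univ.filter fun s : Fin n => sDepth s = j).card ≤ 2 ^ j := by
  have h : (Finset.univ.filter fun s : Fin n => sDepth s = j).card
      ≤ (Finset.Ico (2 ^ j) (2 ^ (j + 1))).card := by
    refine Finset.card_le_card_of_injOn (fun s => s.val + 1) (fun s hs => ?_) ?_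
    · have hs' := (sDepth_eq_iff s j).1 (by simpa using hs)
      simpa using hs'
    · intro x _ y _ hxy
      exact Fin.ext (by simpa using hxy)
  rw [Nat.card_Ico, pow_succ] at h
  omega

lemma le_card_level {K : ℕ} (hn : n = 2 ^ K - 1) {j : ℕ} (hj : j < K) :
    2 ^ j ≤ (Finset.univ.filter fun s : Fin n => sDepth s = j).card := by
  have h : (Finset.Ico (2 ^ j) (2 ^ (j + 1))).card
      ≤ (Finset.univ.filter fun s : Fin n => sDepth s = j).card := by
    refine Finset.card_le_card_of_surjOn (fun s => s.val + 1) fun i hi => ?_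
    have hi' : 2 ^ j ≤ i ∧ i < 2 ^ (j + 1) := by simpa using hi
    have h1 : 2 ^ (j + 1) ≤ 2 ^ K := Nat.pow_le_pow_right (by norm_num) hj
    have h2 : 0 < 2 ^ j := by positivity
    have h3 : i - 1 + 1 = i := by omega
    refine ⟨⟨i - 1, by omega⟩, ?_, h3⟩
    simpa [sDepth_eq_iff, h3] using hi'
  rw [Nat.card_Ico, pow_succ] at h
  omega

lemma sDepth_lt {K : ℕ} (hn : n = 2 ^ K - 1) (s : Fin n) : sDepth s < K := by
  have := s.isLt
  exact Nat.log_lt_of_lt_pow (by omega) (by omega)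

lemma card_item_level (c : Fin n ≃ Fin n) (j : ℕ) :
    (Finset.univ.filter fun v : Fin n => sDepth (c v) = j).card
      = (Finset.univ.filter fun s : Fin n => sDepth s = j).card := by
  refine Finset.card_equiv c fun v => ?_
  simp

lemma sDepth_eq_sDepth_sParent_add_one {s : Fin n} (hs : s.val ≠ 0) :
    sDepth s = sDepth (sParent s) + 1 := by
  have h : (s.val + 1) / 2 - 1 + 1 = (s.val + 1) / 2 := by omega
  simp only [sDepth, sParent, h]
  exact Nat.log_of_one_lt_of_le (by norm_num) (by omega)

lemma sParent_eq_self {s : Fin n} (hs : s.val = 0) : sParent s = s := by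
  ext
  simp [sParent, hs]

end Levels

section Ranks

variable {n : ℕ} (r0 : Fin n ≃ Fin n) (σ : ℕ → Fin n)

lemma itemRank_succ (t : ℕ) (v : Fin n) :
    itemRank r0 σ (t + 1) v =
      if v = σ t then 1
      else if itemRank r0 σ t v < itemRank r0 σ t (σ t) then itemRank r0 σ t v + 1
      else itemRank r0 σ t v := rfl

lemma itemRank_pos (t : ℕ) (v : Fin n) : 1 ≤ itemRank r0 σ t v := by
  induction t with
  | zero => simp [itemRank]
  | succ t ih => rw [itemRank_succ]; split_ifs <;> omega

lemma itemRank_le (t : ℕ) (v : Fin n) : itemRank r0 σ t v ≤ n := by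
  induction t generalizing v with
  | zero => exact (r0 v).isLt
  | succ t ih =>
    have h1 := ih v
    have h2 := ih (σ t)
    have h3 := v.isLt
    rw [itemRank_succ]
    split_ifs <;> omega

lemma itemRank_injective (t : ℕ) : Function.Injective (itemRank r0 σ t) := by
  induction t with
  | zero =>
    intro x y h
    exact r0.injective (Fin.ext (by simpa [itemRank] using h))
  | succ t ih =>
    intro x y h
    have hx := itemRank_pos r0 σ t x
    have hy := itemRank_pos r0 σ t y
    have hu := itemRank_pos r0 σ t (σ t)
    have hxu : itemRank r0 σ t x = itemRank r0 σ t (σ t) → x = σ t := fun e => ih e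
    have hyu : itemRank r0 σ t y = itemRank r0 σ t (σ t) → y = σ t := fun e => ih e
    have hxy : itemRank r0 σ t x = itemRank r0 σ t y → x = y := fun e => ih e
    rw [itemRank_succ, itemRank_succ] at h
    split_ifs at h with h1 h2 h3 h4 h5 h6 h7 <;>
      first
        | exact h1.trans h2.symm
        | (exfalso; omega)
        | (apply hxy; omega)

lemma itemRank_le_card_lt (t : ℕ) (u : Fin n) :
    itemRank r0 σ t u
      ≤ (Finset.univ.filter fun x => itemRank r0 σ t x < itemRank r0 σ t u).card + 1 := by
  have himg : Finset.univ.image (itemRank r0 σ t) = Finset.Icc 1 n := by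
    apply Finset.eq_of_subset_of_card_le
    · intro i hi
      obtain ⟨v, -, rfl⟩ := Finset.mem_image.1 hi
      exact Finset.mem_Icc.2 ⟨itemRank_pos r0 σ t v, itemRank_le r0 σ t v⟩
    · rw [Finset.card_image_of_injective _ (itemRank_injective r0 σ t)]
      simp
  have h : (Finset.Ico 1 (itemRank r0 σ t u)).card
      ≤ (Finset.univ.filter fun x => itemRank r0 σ t x < itemRank r0 σ t u).card := by
    refine Finset.card_le_card_of_surjOn (itemRank r0 σ t) fun i hi => ?_
    have hi' : 1 ≤ i ∧ i < itemRank r0 σ t u := by simpa using hi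
    have hu := itemRank_le r0 σ t u
    have hmem : i ∈ Finset.univ.image (itemRank r0 σ t) := by
      rw [himg]
      exact Finset.mem_Icc.2 ⟨hi'.1, by omega⟩
    obtain ⟨v, -, rfl⟩ := Finset.mem_image.1 hmem
    exact ⟨v, by simpa using hi'.2, rfl⟩
  rw [Nat.card_Ico] at h
  omega

lemma card_le_of_itemRank_le (t : ℕ) (s : Finset (Fin n)) (b : ℕ)
    (h : ∀ x ∈ s, itemRank r0 σ t x ≤ b) : s.card ≤ b := by
  have := Finset.card_le_card_of_injOn (s := s) (t := Finset.Icc 1 b) (itemRank r0 σ t)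
    (fun x hx => by simpa using ⟨itemRank_pos r0 σ t x, h x hx⟩)
    (itemRank_injective r0 σ t).injOn
  simpa using this

end Ranks

/-- Potential of an item at Move-Half depth `d` whose rank has binary logarithm `l`. -/
def moveHalfPotential (d l : ℕ) : ℕ := d + (2 * (d / 2) - 1) - 4 * l

lemma moveHalf_step {n K : ℕ} (hn : n = 2 ^ K - 1) (r0 : Fin n ≃ Fin n) (σ : ℕ → Fin n)
    (t : ℕ) (c c' : Fin n ≃ Fin n) (v : Fin n)
    (hv : sDepth (c v) = sDepth (c (σ t)) / 2)
    (hmax : ∀ x : Fin n, sDepth (c x) = sDepth (c (σ t)) / 2 →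
      itemRank r0 σ t x ≤ itemRank r0 σ t v)
    (hc : c' = c.trans (Equiv.swap (c (σ t)) (c v))) :
    sDepth (c (σ t))
        + ∑ x, moveHalfPotential (sDepth (c' x)) (Nat.log 2 (itemRank r0 σ (t + 1) x))
      ≤ ∑ x, moveHalfPotential (sDepth (c x)) (Nat.log 2 (itemRank r0 σ t x))
        + 4 * Nat.log 2 (itemRank r0 σ t (σ t)) := by
  have hu' : sDepth (c' (σ t)) = sDepth (c (σ t)) / 2 := by simp [hc, hv]
  have hv' : sDepth (c' v) = sDepth (c (σ t)) := by simp [hc]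
  have hlogu : Nat.log 2 (itemRank r0 σ (t + 1) (σ t)) = 0 := by simp [itemRank_succ]
  have hlog : ∀ x, x ≠ σ t →
      Nat.log 2 (itemRank r0 σ t x) ≤ Nat.log 2 (itemRank r0 σ (t + 1) x) := by
    intro x hx
    apply Nat.log_mono_right
    rw [itemRank_succ, if_neg hx]
    split_ifs <;> omega
  have hrank : 2 ^ (sDepth (c (σ t)) / 2) ≤ itemRank r0 σ t v := by
    refine le_trans (le_card_level hn (j := sDepth (c (σ t)) / 2) ?_) ?_
    · have := sDepth_lt hn (c (σ t))
      omega
    · rw [← card_item_level c]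
      exact card_le_of_itemRank_le r0 σ t _ _ fun x hx => hmax x (by simpa using hx)
  have hlogv : sDepth (c (σ t)) / 2 ≤ Nat.log 2 (itemRank r0 σ t v) :=
    Nat.le_log_of_pow_le (by norm_num) hrank
  have key : ∀ x,
      moveHalfPotential (sDepth (c' x)) (Nat.log 2 (itemRank r0 σ (t + 1) x))
          + (if x = σ t then sDepth (c (σ t)) else 0)
        ≤ moveHalfPotential (sDepth (c x)) (Nat.log 2 (itemRank r0 σ t x))
          + (if x = σ t then 4 * Nat.log 2 (itemRank r0 σ t (σ t)) else 0) := by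
    intro x
    by_cases hxu : x = σ t
    · subst hxu
      simp only [if_true, hu', hlogu, moveHalfPotential]
      omega
    · have h1 := hlog x hxu
      simp only [if_neg hxu, add_zero]
      by_cases hxv : x = v
      · subst hxv
        rw [hv']
        rcases Nat.lt_or_ge (sDepth (c (σ t))) 2 with hd | hd
        · rcases Nat.eq_zero_or_pos (sDepth (c (σ t))) with h0 | h0
          · simp [moveHalfPotential, h0]
          · have h2 : 2 ^ 1 ≤ itemRank r0 σ (t + 1) x := by
              have hp := itemRank_pos r0 σ t x
              have hpu := itemRank_pos r0 σ t (σ t)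
              have hne := (itemRank_injective r0 σ t).ne hxu
              rw [itemRank_succ, if_neg hxu]
              split_ifs <;> omega
            have h3 := Nat.le_log_of_pow_le (b := 2) (by norm_num) h2
            simp only [moveHalfPotential]
            omega
        · simp only [moveHalfPotential]
          omega
      · have hx' : c' x = c x := by
          rw [hc, Equiv.trans_apply]
          exact Equiv.swap_apply_of_ne_of_ne (c.injective.ne hxu) (c.injective.ne hxv)
        rw [hx']
        simp only [moveHalfPotential]
        omega
  have hsum := Finset.sum_le_sum fun x (_ : x ∈ Finset.univ) => key x
  simp only [Finset.sum_add_distrib, Finset.sum_ite_eq', Finset.mem_univ, if_true] at hsum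
  omega

section OptPotential

variable {ι : Type*} [Fintype ι]

/-- The items of smaller rank than `v` that are stored strictly deeper than `v`. -/
def deeperRecent (r δ : ι → ℕ) (v : ι) : Finset ι :=
  Finset.univ.filter fun x => r x < r v ∧ δ v < δ x

lemma mem_deeperRecent {r δ : ι → ℕ} {v x : ι} :
    x ∈ deeperRecent r δ v ↔ r x < r v ∧ δ v < δ x := by
  simp [deeperRecent]

/-- Potential comparing the ranks `r` with the depths `δ` in an offline configuration. -/
noncomputable def optPotential (r δ : ι → ℕ) : ℝ :=
  ∑ v, Real.logb 2 (1 + ((deeperRecent r δ v).card : ℝ) / 2 ^ δ v)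

lemma logb_term_nonneg (m d : ℕ) : 0 ≤ Real.logb 2 (1 + (m : ℝ) / 2 ^ d) := by
  apply Real.logb_nonneg (by norm_num)
  have : 0 ≤ (m : ℝ) / 2 ^ d := by positivity
  linarith

lemma optPotential_nonneg (r δ : ι → ℕ) : 0 ≤ optPotential r δ :=
  Finset.sum_nonneg fun _ _ => logb_term_nonneg _ _

lemma logb_term_mono {m m' : ℕ} (d : ℕ) (h : m ≤ m') :
    Real.logb 2 (1 + (m : ℝ) / 2 ^ d) ≤ Real.logb 2 (1 + (m' : ℝ) / 2 ^ d) := by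
  apply Real.logb_le_logb_of_le (by norm_num) (by positivity)
  gcongr

lemma logb_two_one_add_le {x : ℝ} (hx : 0 ≤ x) : Real.logb 2 (1 + x) ≤ 2 * x := by
  have h2 : (1 / 2 : ℝ) ≤ Real.log 2 := by linarith [Real.log_two_gt_d9]
  have h1 : Real.log (1 + x) ≤ x := by
    linarith [Real.log_le_sub_one_of_pos (show 0 < 1 + x by linarith)]
  rw [Real.logb, div_le_iff₀ (by linarith)]
  nlinarith

lemma logb_term_succ_le {m m' : ℕ} (d : ℕ) (h : m' ≤ m + 1) :
    Real.logb 2 (1 + (m' : ℝ) / 2 ^ d) ≤ Real.logb 2 (1 + (m : ℝ) / 2 ^ d) + 2 / 2 ^ d := by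
  have hN : (0 : ℝ) < 2 ^ d := by positivity
  have hm : (0 : ℝ) ≤ (m : ℝ) / 2 ^ d := by positivity
  have hinv : (0 : ℝ) ≤ 1 / 2 ^ d := by positivity
  calc Real.logb 2 (1 + (m' : ℝ) / 2 ^ d)
      ≤ Real.logb 2 (1 + ((m + 1 : ℕ) : ℝ) / 2 ^ d) := logb_term_mono d h
    _ ≤ Real.logb 2 ((1 + (m : ℝ) / 2 ^ d) * (1 + 1 / 2 ^ d)) := by
        apply Real.logb_le_logb_of_le (by norm_num) (by positivity)
        push_cast
        rw [add_div]
        nlinarith [mul_nonneg hm hinv]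
    _ = Real.logb 2 (1 + (m : ℝ) / 2 ^ d) + Real.logb 2 (1 + 1 / 2 ^ d) :=
        Real.logb_mul (by positivity) (by positivity)
    _ ≤ _ := by
        have := logb_two_one_add_le hinv
        have e : (2 : ℝ) / 2 ^ d = 2 * (1 / 2 ^ d) := by ring
        linarith

lemma sum_inv_pow_level_le (δ : ι → ℕ)
    (hδ : ∀ j, (Finset.univ.filter fun v => δ v = j).card ≤ 2 ^ j) (j : ℕ) :
    ∑ v, (if δ v = j then (2 : ℝ) / 2 ^ δ v else 0) ≤ 2 := by
  have h : ∀ v, (if δ v = j then (2 : ℝ) / 2 ^ δ v else 0)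
      = if δ v = j then (2 : ℝ) / 2 ^ j else 0 := by
    intro v
    split_ifs with hv
    · rw [hv]
    · rfl
  simp only [h]
  rw [← Finset.sum_filter, Finset.sum_const, nsmul_eq_mul]
  have hc : ((Finset.univ.filter fun v => δ v = j).card : ℝ) ≤ 2 ^ j := by exact_mod_cast hδ j
  have hp : (0 : ℝ) < 2 ^ j := by positivity
  rw [mul_div_assoc', div_le_iff₀ hp]
  linarith

lemma sum_inv_pow_lt_le (δ : ι → ℕ)
    (hδ : ∀ j, (Finset.univ.filter fun v => δ v = j).card ≤ 2 ^ j) (o : ℕ) :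
    ∑ v, (if δ v < o then (2 : ℝ) / 2 ^ δ v else 0) ≤ 2 * o := by
  induction o with
  | zero => simp
  | succ o ih =>
    have h : ∀ v, (if δ v < o + 1 then (2 : ℝ) / 2 ^ δ v else 0)
        = (if δ v < o then (2 : ℝ) / 2 ^ δ v else 0)
          + (if δ v = o then (2 : ℝ) / 2 ^ δ v else 0) := by
      intro v
      rcases lt_trichotomy (δ v) o with hv | hv | hv
      · simp [hv, hv.ne, hv.trans (Nat.lt_succ_self o)]
      · simp [hv]
      · simp [hv.ne', hv.le.not_gt, show ¬ δ v < o + 1 by omega]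
    simp only [h, Finset.sum_add_distrib]
    have := sum_inv_pow_level_le δ hδ o
    push_cast
    linarith

lemma card_depth_le [DecidableEq ι] (δ : ι → ℕ)
    (hδ : ∀ j, (Finset.univ.filter fun v => δ v = j).card ≤ 2 ^ j) (o : ℕ) :
    (Finset.univ.filter fun v => δ v ≤ o).card + 1 ≤ 2 ^ (o + 1) := by
  induction o with
  | zero => simpa using hδ 0
  | succ o ih =>
    have h : (Finset.univ.filter fun v => δ v ≤ o + 1)
        = (Finset.univ.filter fun v => δ v ≤ o) ∪ (Finset.univ.filter fun v => δ v = o + 1) := by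
      ext v
      simp only [Finset.mem_filter, Finset.mem_univ, true_and, Finset.mem_union]
      omega
    have h1 := Finset.card_union_le (Finset.univ.filter fun v => δ v ≤ o)
      (Finset.univ.filter fun v => δ v = o + 1)
    have h2 := hδ (o + 1)
    rw [h, pow_succ]
    omega

lemma log_le_logb_term [DecidableEq ι] (r δ : ι → ℕ)
    (hδ : ∀ j, (Finset.univ.filter fun v => δ v = j).card ≤ 2 ^ j) (u : ι) (hpos : 1 ≤ r u)
    (hr : r u ≤ (Finset.univ.filter fun x => r x < r u).card + 1) :
    (Nat.log 2 (r u) : ℝ)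
      ≤ Real.logb 2 (1 + ((deeperRecent r δ u).card : ℝ) / 2 ^ δ u) + 2 * δ u := by
  have hsub : (Finset.univ.filter fun x => r x < r u)
      ⊆ deeperRecent r δ u ∪ (Finset.univ.filter fun v => δ v ≤ δ u).erase u := by
    intro x hx
    have hx' : r x < r u := by simpa using hx
    have hne : x ≠ u := by rintro rfl; omega
    simp only [Finset.mem_union, mem_deeperRecent, Finset.mem_erase, Finset.mem_filter,
      Finset.mem_univ, true_and]
    rcases Nat.lt_or_ge (δ u) (δ x) with h | h
    · exact Or.inl ⟨hx', h⟩
    · exact Or.inr ⟨hne, h⟩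
  have hcard := (Finset.card_le_card hsub).trans (Finset.card_union_le _ _)
  have herase := Finset.card_erase_add_one
    (show u ∈ Finset.univ.filter (fun v => δ v ≤ δ u) by simp)
  have hle := card_depth_le δ hδ (δ u)
  have hnat : r u + 1 ≤ (deeperRecent r δ u).card + 2 ^ (δ u + 1) := by omega
  set I := (deeperRecent r δ u).card
  have hlog : (Nat.log 2 (r u) : ℝ) ≤ Real.logb 2 (r u) := by
    rw [Real.le_logb_iff_rpow_le (by norm_num) (by exact_mod_cast hpos), Real.rpow_natCast]
    exact_mod_cast Nat.pow_log_le_self 2 (by omega)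
  have hprod : (r u : ℝ) ≤ (1 + (I : ℝ) / 2 ^ δ u) * 2 ^ (2 * δ u) := by
    have h1 : (r u : ℝ) + 1 ≤ I + 2 * 2 ^ δ u := by
      have : ((r u + 1 : ℕ) : ℝ) ≤ ((I + 2 ^ (δ u + 1) : ℕ) : ℝ) := by exact_mod_cast hnat
      push_cast at this
      rw [pow_succ] at this
      linarith
    have hN : (1 : ℝ) ≤ 2 ^ δ u := one_le_pow₀ (by norm_num)
    have e : (1 + (I : ℝ) / 2 ^ δ u) * 2 ^ (2 * δ u) = 2 ^ δ u * 2 ^ δ u + I * 2 ^ δ u := by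
      rw [two_mul, pow_add]
      field_simp
    rw [e]
    nlinarith [mul_nonneg (Nat.cast_nonneg (α := ℝ) I) (sub_nonneg.2 hN),
      sq_nonneg ((2 : ℝ) ^ δ u - 1)]
  calc (Nat.log 2 (r u) : ℝ) ≤ Real.logb 2 (r u) := hlog
    _ ≤ Real.logb 2 ((1 + (I : ℝ) / 2 ^ δ u) * 2 ^ (2 * δ u)) :=
        Real.logb_le_logb_of_le (by norm_num) (by exact_mod_cast hpos) hprod
    _ = _ := by
        rw [Real.logb_mul (by positivity) (by positivity), Real.logb_pow,
          Real.logb_self_eq_one (by norm_num)]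
        push_cast
        ring

lemma optPotential_access [DecidableEq ι] (r r' δ : ι → ℕ) (u : ι)
    (hδ : ∀ j, (Finset.univ.filter fun v => δ v = j).card ≤ 2 ^ j) (hpos : ∀ v, 1 ≤ r v)
    (hr : r u ≤ (Finset.univ.filter fun x => r x < r u).card + 1)
    (hr' : ∀ v, r' v = if v = u then 1 else if r v < r u then r v + 1 else r v) :
    Nat.log 2 (r u) + optPotential r' δ ≤ optPotential r δ + 4 * δ u := by
  have hu' : r' u = 1 := by simp [hr']
  have hpos' : ∀ v, 1 ≤ r' v := by
    intro v
    have := hpos v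
    rw [hr']
    split_ifs <;> omega
  have hlt : ∀ v x, v ≠ u → x ≠ u → r' x < r' v → r x < r v := by
    intro v x hv hx h
    rw [hr' x, hr' v, if_neg hv, if_neg hx] at h
    split_ifs at h <;> omega
  have hempty : deeperRecent r' δ u = ∅ := by
    ext x
    have := hpos' x
    simp only [mem_deeperRecent, hu', Finset.notMem_empty, iff_false]
    omega
  have key : ∀ v, Real.logb 2 (1 + ((deeperRecent r' δ v).card : ℝ) / 2 ^ δ v)
      + (if v = u then Real.logb 2 (1 + ((deeperRecent r δ u).card : ℝ) / 2 ^ δ u) else 0)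
      ≤ Real.logb 2 (1 + ((deeperRecent r δ v).card : ℝ) / 2 ^ δ v)
        + (if δ v < δ u then (2 : ℝ) / 2 ^ δ v else 0) := by
    intro v
    by_cases hv : v = u
    · subst hv
      simp [hempty]
    · rw [if_neg hv, add_zero]
      split_ifs with hd
      · apply logb_term_succ_le
        refine le_trans (Finset.card_le_card ?_) (Finset.card_insert_le u _)
        intro x hx
        rw [mem_deeperRecent] at hx
        by_cases hxu : x = u
        · simp [hxu]
        · exact Finset.mem_insert_of_mem (mem_deeperRecent.2 ⟨hlt v x hv hxu hx.1, hx.2⟩)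
      · rw [add_zero]
        apply logb_term_mono
        apply Finset.card_le_card
        intro x hx
        rw [mem_deeperRecent] at hx
        have hxu : x ≠ u := by rintro rfl; exact hd hx.2
        exact mem_deeperRecent.2 ⟨hlt v x hv hxu hx.1, hx.2⟩
  have hsum := Finset.sum_le_sum fun v (_ : v ∈ Finset.univ) => key v
  simp only [Finset.sum_add_distrib, Finset.sum_ite_eq', Finset.mem_univ, if_true] at hsum
  have h1 := sum_inv_pow_lt_le δ hδ (δ u)
  have h2 := log_le_logb_term r δ hδ u (hpos u) hr
  unfold optPotential
  linarith

lemma optPotential_swap [DecidableEq ι] (r δ δ' : ι → ℕ) (a b : ι) (k : ℕ)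
    (hδ : ∀ j, (Finset.univ.filter fun v => δ v = j).card ≤ 2 ^ j)
    (hδ' : ∀ j, (Finset.univ.filter fun v => δ' v = j).card ≤ 2 ^ j)
    (ha : δ a = k + 1) (hb : δ b = k) (ha' : δ' a = k) (hb' : δ' b = k + 1)
    (hne : ∀ x, x ≠ a → x ≠ b → δ' x = δ x) :
    optPotential r δ' ≤ optPotential r δ + 4 := by
  have hab : a ≠ b := by rintro rfl; omega
  have hcases : ∀ x, (x = a ∧ δ x = k + 1 ∧ δ' x = k) ∨ (x = b ∧ δ x = k ∧ δ' x = k + 1) ∨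
      (x ≠ a ∧ x ≠ b ∧ δ' x = δ x) := by
    intro x
    by_cases h1 : x = a
    · subst h1; exact Or.inl ⟨rfl, ha, ha'⟩
    · by_cases h2 : x = b
      · subst h2; exact Or.inr (Or.inl ⟨rfl, hb, hb'⟩)
      · exact Or.inr (Or.inr ⟨h1, h2, hne x h1 h2⟩)
  have key : ∀ v, Real.logb 2 (1 + ((deeperRecent r δ' v).card : ℝ) / 2 ^ δ' v)
      ≤ Real.logb 2 (1 + ((deeperRecent r δ v).card : ℝ) / 2 ^ δ v)
        + (if v = a then 2 else 0) + (if δ v = k then (2 : ℝ) / 2 ^ δ v else 0) := by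
    intro v
    have hnn : (0 : ℝ) ≤ if δ v = k then (2 : ℝ) / 2 ^ δ v else 0 := by
      split_ifs <;> positivity
    by_cases hva : v = a
    · subst hva
      have hcard : (deeperRecent r δ' v).card ≤ (deeperRecent r δ v).card + 2 ^ (k + 1) := by
        have hsub : deeperRecent r δ' v
            ⊆ deeperRecent r δ v ∪ Finset.univ.filter fun x => δ' x = k + 1 := by
          intro x hx
          rw [mem_deeperRecent] at hx
          rw [Finset.mem_union, mem_deeperRecent, Finset.mem_filter]
          by_cases hxk : δ' x = k + 1
          · exact Or.inr ⟨Finset.mem_univ x, hxk⟩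
          · refine Or.inl ⟨hx.1, ?_⟩
            rcases hcases x with h | h | h <;> omega
        exact ((Finset.card_le_card hsub).trans (Finset.card_union_le _ _)).trans
          (Nat.add_le_add_left (hδ' (k + 1)) _)
      have hcardR : ((deeperRecent r δ' v).card : ℝ)
          ≤ (deeperRecent r δ v).card + 2 ^ (k + 1) := by exact_mod_cast hcard
      have hle : 1 + ((deeperRecent r δ' v).card : ℝ) / 2 ^ k
          ≤ 2 ^ 2 * (1 + ((deeperRecent r δ v).card : ℝ) / 2 ^ (k + 1)) := by
        have h1 : ((deeperRecent r δ' v).card : ℝ) / 2 ^ k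
            ≤ ((deeperRecent r δ v).card + 2 ^ (k + 1)) / 2 ^ k := by gcongr
        have h2 : ((deeperRecent r δ v).card + 2 ^ (k + 1) : ℝ) / 2 ^ k
            = 2 * (((deeperRecent r δ v).card : ℝ) / 2 ^ (k + 1)) + 2 := by
          rw [pow_succ]
          field_simp
        have h3 : (0 : ℝ) ≤ ((deeperRecent r δ v).card : ℝ) / 2 ^ (k + 1) := by positivity
        linarith
      have hlogb := Real.logb_le_logb_of_le (b := 2) (by norm_num) (by positivity) hle
      rw [Real.logb_mul (by positivity) (by positivity), Real.logb_pow,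
        Real.logb_self_eq_one (by norm_num)] at hlogb
      rw [if_pos rfl, ha', ha, if_neg (by omega)]
      push_cast at hlogb
      linarith
    · rw [if_neg hva, add_zero]
      by_cases hvb : v = b
      · subst hvb
        have hcard : (deeperRecent r δ' v).card ≤ (deeperRecent r δ v).card := by
          apply Finset.card_le_card
          intro x hx
          rw [mem_deeperRecent] at hx ⊢
          refine ⟨hx.1, ?_⟩
          rcases hcases x with h | h | h <;> omega
        have h1 := logb_term_mono (δ' v) hcard
        have h2 : Real.logb 2 (1 + ((deeperRecent r δ v).card : ℝ) / 2 ^ δ' v)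
            ≤ Real.logb 2 (1 + ((deeperRecent r δ v).card : ℝ) / 2 ^ δ v) := by
          apply Real.logb_le_logb_of_le (by norm_num) (by positivity)
          have h3 : (2 : ℝ) ^ δ v ≤ 2 ^ δ' v := pow_le_pow_right₀ (by norm_num) (by omega)
          gcongr
        linarith
      · have hv := hne v hva hvb
        rw [hv]
        split_ifs with hk
        · apply logb_term_succ_le
          refine le_trans (Finset.card_le_card ?_) (Finset.card_insert_le b _)
          intro x hx
          rw [mem_deeperRecent] at hx
          rw [Finset.mem_insert, mem_deeperRecent]
          rcases hcases x with h | h | h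
          · exact Or.inr ⟨hx.1, by omega⟩
          · exact Or.inl h.1
          · exact Or.inr ⟨hx.1, by omega⟩
        · rw [add_zero]
          apply logb_term_mono
          apply Finset.card_le_card
          intro x hx
          rw [mem_deeperRecent] at hx ⊢
          refine ⟨hx.1, ?_⟩
          rcases hcases x with h | h | h <;> omega
  have hsum := Finset.sum_le_sum fun v (_ : v ∈ Finset.univ) => key v
  simp only [Finset.sum_add_distrib, Finset.sum_ite_eq', Finset.mem_univ, if_true] at hsum
  have h1 := sum_inv_pow_level_le δ hδ k
  unfold optPotential
  linarith

end OptPotential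

lemma card_conf_level_le {n : ℕ} (c : Fin n ≃ Fin n) (j : ℕ) :
    (Finset.univ.filter fun v : Fin n => sDepth (c v) = j).card ≤ 2 ^ j :=
  (card_item_level c j).trans_le (card_level_le j)

lemma optPotential_single_swap {n : ℕ} (r : Fin n → ℕ) (c : Fin n ≃ Fin n) (s : Fin n) :
    optPotential r (fun v => sDepth (c.trans (Equiv.swap s (sParent s)) v))
      ≤ optPotential r (fun v => sDepth (c v)) + 4 := by
  by_cases hs : s.val = 0
  · rw [sParent_eq_self hs]
    simp
  · have hd := sDepth_eq_sDepth_sParent_add_one hs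
    refine optPotential_swap r _ _ (c.symm s) (c.symm (sParent s)) (sDepth (sParent s))
      (card_conf_level_le c) (card_conf_level_le _) (by simpa using hd) (by simp) (by simp)
      (by simpa using hd) fun x hxa hxb => ?_
    rw [Equiv.trans_apply, Equiv.swap_apply_of_ne_of_ne]
    · exact fun h => hxa (by simp [← h])
    · exact fun h => hxb (by simp [← h])

lemma optPotential_applySwaps {n : ℕ} (r : Fin n → ℕ) (l : List (Fin n)) (c : Fin n ≃ Fin n) :
    optPotential r (fun v => sDepth (applySwaps l c v))
      ≤ optPotential r (fun v => sDepth (c v)) + 4 * l.length := by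
  induction l generalizing c with
  | nil => simp [applySwaps]
  | cons s l ih =>
    have h1 := ih (c.trans (Equiv.swap s (sParent s)))
    have h2 := optPotential_single_swap r c s
    have h3 : applySwaps (s :: l) c = applySwaps l (c.trans (Equiv.swap s (sParent s))) := rfl
    rw [h3, List.length_cons]
    push_cast
    linarith

lemma optPotential_eq_zero {n : ℕ} (r : Fin n → ℕ) (δ : Fin n → ℕ)
    (h : ∀ v, δ v = Nat.log 2 (r v)) : optPotential r δ = 0 := by
  refine Finset.sum_eq_zero fun v _ => ?_
  have hempty : deeperRecent r δ v = ∅ := by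
    ext x
    simp only [mem_deeperRecent, Finset.notMem_empty, iff_false, h]
    rintro ⟨h1, h2⟩
    exact absurd (Nat.log_mono_right (b := 2) h1.le) (by omega)
  simp [hempty]

/-- Move-Half's access cost is at most four times the access cost of MRU trees. -/
lemma moveHalf_access_le {K n : ℕ} (hn : n = 2 ^ K - 1)
    (r0 : Fin n ≃ Fin n) (σ : ℕ → Fin n) (m : ℕ) (conf : ℕ → (Fin n ≃ Fin n))
    (hinit : ∀ v : Fin n, sDepth (conf 0 v) = Nat.log 2 (itemRank r0 σ 0 v))
    (hMH : ∀ t, ∃ v : Fin n,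
        sDepth (conf t v) = sDepth (conf t (σ t)) / 2 ∧
        (∀ x : Fin n, sDepth (conf t x) = sDepth (conf t (σ t)) / 2 →
          itemRank r0 σ t x ≤ itemRank r0 σ t v) ∧
        conf (t + 1) = (conf t).trans (Equiv.swap (conf t (σ t)) (conf t v))) :
    ∑ t ∈ Finset.range m, sDepth (conf t (σ t))
      ≤ 4 * ∑ t ∈ Finset.range m, Nat.log 2 (itemRank r0 σ t (σ t)) := by
  suffices h : ∑ t ∈ Finset.range m, sDepth (conf t (σ t))
      + ∑ x, moveHalfPotential (sDepth (conf m x)) (Nat.log 2 (itemRank r0 σ m x))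
      ≤ 4 * ∑ t ∈ Finset.range m, Nat.log 2 (itemRank r0 σ t (σ t)) by omega
  induction m with
  | zero =>
    simp only [Finset.range_zero, Finset.sum_empty, mul_zero, zero_add, nonpos_iff_eq_zero]
    refine Finset.sum_eq_zero fun x _ => ?_
    rw [hinit, moveHalfPotential]
    omega
  | succ m ih =>
    obtain ⟨v, hv, hmax, hc⟩ := hMH m
    have := moveHalf_step hn r0 σ m (conf m) (conf (m + 1)) v hv hmax hc
    rw [Finset.sum_range_succ, Finset.sum_range_succ]
    omega

/-- The access cost of MRU trees is at most four times the cost of any offline algorithm. -/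
lemma mru_access_le {n : ℕ} (r0 : Fin n ≃ Fin n) (σ : ℕ → Fin n) (m : ℕ)
    (optConf : ℕ → (Fin n ≃ Fin n)) (optSwaps : ℕ → List (Fin n))
    (hinit : ∀ v : Fin n, sDepth (optConf 0 v) = Nat.log 2 (itemRank r0 σ 0 v))
    (hstep : ∀ t, optConf (t + 1) = applySwaps (optSwaps t) (optConf t)) :
    ∑ t ∈ Finset.range m, Nat.log 2 (itemRank r0 σ t (σ t))
      ≤ 4 * ∑ t ∈ Finset.range m, (sDepth (optConf t (σ t)) + (optSwaps t).length) := by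
  suffices h : ((∑ t ∈ Finset.range m, Nat.log 2 (itemRank r0 σ t (σ t)) : ℕ) : ℝ)
      + optPotential (itemRank r0 σ m) (fun v => sDepth (optConf m v))
      ≤ ((4 * ∑ t ∈ Finset.range m,
          (sDepth (optConf t (σ t)) + (optSwaps t).length) : ℕ) : ℝ) by
    have := optPotential_nonneg (itemRank r0 σ m) (fun v => sDepth (optConf m v))
    exact_mod_cast (le_of_add_le_of_nonneg_left h this)
  induction m with
  | zero => simp [optPotential_eq_zero _ _ hinit]
  | succ m ih =>
    have h1 := optPotential_access (itemRank r0 σ m) (itemRank r0 σ (m + 1))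
      (fun v => sDepth (optConf m v)) (σ m) (card_conf_level_le (optConf m))
      (itemRank_pos r0 σ m) (itemRank_le_card_lt r0 σ m (σ m)) (itemRank_succ r0 σ m)
    have h2 := optPotential_applySwaps (itemRank r0 σ (m + 1)) (optSwaps m) (optConf m)
    rw [← hstep] at h2
    rw [Finset.sum_range_succ, Finset.sum_range_succ]
    push_cast at ih ⊢
    linarith

/-- The Move-Half algorithm is dynamically optimal: for every request sequence `σ`, the
total cost of Move-Half (per request to an item at depth `d`: access cost `d` plus
adjustment cost `3d` for the interchange, i.e. `4d` in total) is at most `64` times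
the total cost (access plus one per swap) of any offline algorithm — in particular
of an optimal offline algorithm `OPT` — serving `σ` from the same initial
configuration. -/
theorem movehalf_dynamically_optimal
    (K : ℕ) (hK : 1 ≤ K) (n : ℕ) (hn : n = 2 ^ K - 1)
    (r0 : Fin n ≃ Fin n) (σ : ℕ → Fin n) (m : ℕ)
    (conf : ℕ → (Fin n ≃ Fin n))
    (hinit : ∀ v : Fin n, sDepth (conf 0 v) = Nat.log 2 (itemRank r0 σ 0 v))
    (hMH : ∀ t, ∃ v : Fin n,
        sDepth (conf t v) = sDepth (conf t (σ t)) / 2 ∧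
        (∀ x : Fin n, sDepth (conf t x) = sDepth (conf t (σ t)) / 2 →
          itemRank r0 σ t x ≤ itemRank r0 σ t v) ∧
        conf (t + 1) = (conf t).trans (Equiv.swap (conf t (σ t)) (conf t v)))
    (optConf : ℕ → (Fin n ≃ Fin n)) (optSwaps : ℕ → List (Fin n))
    (hsame : optConf 0 = conf 0)
    (hstep : ∀ t, optConf (t + 1) = applySwaps (optSwaps t) (optConf t)) :
    ∑ t ∈ Finset.range m, 4 * sDepth (conf t (σ t))
      ≤ 64 * ∑ t ∈ Finset.range m,
          (sDepth (optConf t (σ t)) + (optSwaps t).length) := by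
  have h1 := moveHalf_access_le hn r0 σ m conf hinit hMH
  have h2 := mru_access_le r0 σ m optConf optSwaps (by simpa [hsame] using hinit) hstep
  rw [← Finset.mul_sum]
  omega
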